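/- arXiv:gr-qc/0209098 — 2 statements merged into one kernel-verified Lean document; each statement's English description precedes it below -/
import Mathlib

section
/- Mutual covering is an equivalence relation on boundary points of envelopments of a fixed manifold M: defining p ∼ q for boundary points p ∈ ∂φ(M) and q ∈ ∂ψ(M) of envelopments (M, M̂, φ) and (M, M̂', ψ) by requiring {p} ▷ {q} and {q} ▷ {p}, the relation ∼ is reflexive (p ∼ p for every boundary point p of every envelopment), symmetric (p ∼ q implies q ∼ p), and transitive (if p ∼ q and q ∼ r, for boundary points p, q, r of three envelopments of M, then p ∼ r). -/
open Set Topology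

/-- `Covers φ ψ B B'` : the boundary set `B` (of the envelopment with embedding `φ`)
covers the boundary set `B'` (of the envelopment with embedding `ψ`): for every open
neighbourhood `U` of `B` there is an open neighbourhood `U'` of `B'` with
`φ(ψ⁻¹(U' ∩ ψ(M))) ⊆ U`. -/
def Covers {M M₁ M₂ : Type*} [TopologicalSpace M] [TopologicalSpace M₁] [TopologicalSpace M₂]
    (φ : M → M₁) (ψ : M → M₂) (B : Set M₁) (B' : Set M₂) : Prop :=
  ∀ U : Set M₁, IsOpen U → B ⊆ U →
    ∃ U' : Set M₂, IsOpen U' ∧ B' ⊆ U' ∧ φ '' (ψ ⁻¹' (U' ∩ Set.range ψ)) ⊆ U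

/-- `BPEquiv φ ψ p q` : the boundary points `p ∈ ∂φ(M)` and `q ∈ ∂ψ(M)` mutually cover
each other, i.e. `{p} ▷ {q}` and `{q} ▷ {p}`. -/
def BPEquiv {M M₁ M₂ : Type*} [TopologicalSpace M] [TopologicalSpace M₁] [TopologicalSpace M₂]
    (φ : M → M₁) (ψ : M → M₂) (p : M₁) (q : M₂) : Prop :=
  Covers φ ψ {p} {q} ∧ Covers ψ φ {q} {p}

theorem Covers.refl {M M₁ : Type*} [TopologicalSpace M] [TopologicalSpace M₁]
    (φ : M → M₁) (B : Set M₁) : Covers φ φ B B := by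
  intro U hU hB
  refine ⟨U, hU, hB, ?_⟩
  rintro _ ⟨x, hx, rfl⟩
  exact hx.1

theorem Covers.trans {M M₁ M₂ M₃ : Type*} [TopologicalSpace M] [TopologicalSpace M₁]
    [TopologicalSpace M₂] [TopologicalSpace M₃] {φ : M → M₁} {ψ : M → M₂} {χ : M → M₃}
    {B₁ : Set M₁} {B₂ : Set M₂} {B₃ : Set M₃}
    (h₁₂ : Covers φ ψ B₁ B₂) (h₂₃ : Covers ψ χ B₂ B₃) : Covers φ χ B₁ B₃ := by
  intro U hU hB
  obtain ⟨V, hV, hBV, hVU⟩ := h₁₂ U hU hB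
  obtain ⟨W, hW, hBW, hWV⟩ := h₂₃ V hV hBV
  refine ⟨W, hW, hBW, ?_⟩
  rintro _ ⟨x, hx, rfl⟩
  exact hVU ⟨x, ⟨hWV ⟨x, hx, rfl⟩, x, rfl⟩, rfl⟩

/-- Mutual covering is an equivalence relation on boundary points of envelopments of a
fixed manifold `M`: it is reflexive, symmetric and transitive. -/
theorem bpEquiv_equivalence {n : ℕ} {M Mhat Mhat' Mhat'' : Type*}
    [TopologicalSpace M] [ChartedSpace (EuclideanSpace ℝ (Fin n)) M] [ConnectedSpace M]
    [TopologicalSpace Mhat] [ChartedSpace (EuclideanSpace ℝ (Fin n)) Mhat]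
    [TopologicalSpace Mhat'] [ChartedSpace (EuclideanSpace ℝ (Fin n)) Mhat']
    [TopologicalSpace Mhat''] [ChartedSpace (EuclideanSpace ℝ (Fin n)) Mhat'']
    (φ : M → Mhat) (hφ : IsOpenEmbedding φ)
    (ψ : M → Mhat') (hψ : IsOpenEmbedding ψ)
    (χ : M → Mhat'') (hχ : IsOpenEmbedding χ)
    (p : Mhat) (hp : p ∈ frontier (Set.range φ))
    (q : Mhat') (hq : q ∈ frontier (Set.range ψ))
    (r : Mhat'') (hr : r ∈ frontier (Set.range χ)) :
    BPEquiv φ φ p p ∧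
      (BPEquiv φ ψ p q → BPEquiv ψ φ q p) ∧
      (BPEquiv φ ψ p q → BPEquiv ψ χ q r → BPEquiv φ χ p r) := by
  exact ⟨⟨Covers.refl φ {p}, Covers.refl φ {p}⟩, And.symm,
    fun hpq hqr => ⟨hpq.1.trans hqr.1, hqr.2.trans hpq.2⟩⟩
end

section
/- Approachability is transferred by the covering relation: let (M, M̂, φ) and (M, M̂', ψ) be envelopments of the same manifold M, let p ∈ ∂φ(M) and q ∈ ∂ψ(M) be boundary points with {p} ▷ {q}, and let γ : [0, b) → M (with 0 < b ≤ ∞) be a continuous curve. If q is a limit point of ψ ∘ γ as t → b, i.e., there exists a sequence t_n ∈ [0, b) with t_n → b and ψ(γ(t_n)) → q in M̂', then for that same sequence φ(γ(t_n)) → p in M̂; in particular p is a limit point of φ ∘ γ as t → b. -/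
open Set Topology Filter

theorem Covers.tendsto {M M₁ M₂ ι : Type*} [TopologicalSpace M] [TopologicalSpace M₁]
    [TopologicalSpace M₂] {φ : M → M₁} {ψ : M → M₂} {p : M₁} {q : M₂} (h : Covers φ ψ {p} {q})
    {l : Filter ι} {f : ι → M} (hf : Tendsto (fun i => ψ (f i)) l (𝓝 q)) :
    Tendsto (fun i => φ (f i)) l (𝓝 p) := by
  refine tendsto_nhds.2 fun U hU hpU => ?_
  obtain ⟨U', hU', hqU', hsub⟩ := h U hU (singleton_subset_iff.2 hpU)
  filter_upwards [hf (hU'.mem_nhds (singleton_subset_iff.1 hqU'))] with i hi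
  exact hsub ⟨f i, ⟨hi, mem_range_self _⟩, rfl⟩

/-- Approachability is transferred by the covering relation: if `{p} ▷ {q}` for
boundary points `p ∈ ∂φ(M)`, `q ∈ ∂ψ(M)`, and `γ : [0,b) → M` (`0 < b ≤ ∞`) is a
continuous curve such that for some sequence `t_k → b` in `[0,b)` we have
`ψ(γ(t_k)) → q`, then for that same sequence `φ(γ(t_k)) → p`; in particular `p` is a
limit point of `φ ∘ γ`. -/
theorem covers_limit_point {n : ℕ} {M Mhat Mhat' : Type*}
    [TopologicalSpace M] [ChartedSpace (EuclideanSpace ℝ (Fin n)) M] [ConnectedSpace M]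
    [TopologicalSpace Mhat] [ChartedSpace (EuclideanSpace ℝ (Fin n)) Mhat]
    [TopologicalSpace Mhat'] [ChartedSpace (EuclideanSpace ℝ (Fin n)) Mhat']
    (φ : M → Mhat) (hφ : IsOpenEmbedding φ)
    (ψ : M → Mhat') (hψ : IsOpenEmbedding ψ)
    (p : Mhat) (hp : p ∈ frontier (Set.range φ))
    (q : Mhat') (hq : q ∈ frontier (Set.range ψ))
    (hcov : Covers φ ψ {p} {q})
    (b : EReal) (hb : 0 < b)
    (γ : ℝ → M) (hγ : ContinuousOn γ {t : ℝ | 0 ≤ t ∧ (t : EReal) < b})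
    (t : ℕ → ℝ) (ht : ∀ k, 0 ≤ t k ∧ (t k : EReal) < b)
    (htb : Filter.Tendsto (fun k => (t k : EReal)) Filter.atTop (nhds b))
    (hq' : Filter.Tendsto (fun k => ψ (γ (t k))) Filter.atTop (nhds q)) :
    Filter.Tendsto (fun k => φ (γ (t k))) Filter.atTop (nhds p) :=
  hcov.tendsto hq'
end
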